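/- Let K be an algebraically closed field of characteristic 0 and let d ≥ 4. A nonsingular homogeneous polynomial F ∈ K[X,Y,Z] of degree d has an automorphism of order (d−1)² (i.e. Aut(F) contains an element of order (d−1)²) if and only if F is projectively equivalent to X^d + Y^{d−1}·Z + α·X·Z^{d−1} for some α ∈ K^×. In that case Aut(F) is cyclic of order (d−1)². -/

import Mathlib

open MvPolynomial Matrix

noncomputable section

variable {K : Type*} [Field K]

/-- The substitution `F ∘ A`, i.e. `X i ↦ ∑ j, A i j • X j`. -/
def substPoly (A : Matrix (Fin 3) (Fin 3) K) (F : MvPolynomial (Fin 3) K) :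
    MvPolynomial (Fin 3) K :=
  aeval (fun i => ∑ j, A i j • X j) F

lemma substPoly_one (F : MvPolynomial (Fin 3) K) : substPoly 1 F = F := by
  have h : (fun i => ∑ j, (1 : Matrix (Fin 3) (Fin 3) K) i j • X j)
      = (X : Fin 3 → MvPolynomial (Fin 3) K) := by
    funext i
    simp [Matrix.one_apply, ite_smul]
  rw [substPoly, h]
  exact aeval_X_left_apply F

lemma substPoly_smul (A : Matrix (Fin 3) (Fin 3) K) (c : K) (F : MvPolynomial (Fin 3) K) :
    substPoly A (c • F) = c • substPoly A F := by
  unfold substPoly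
  exact _root_.map_smul (aeval fun i => ∑ j, A i j • X j) c F

lemma substPoly_mul (A B : Matrix (Fin 3) (Fin 3) K) (F : MvPolynomial (Fin 3) K) :
    substPoly (A * B) F = substPoly B (substPoly A F) := by
  have hfun : (fun i => ∑ j, (A * B) i j • (X j : MvPolynomial (Fin 3) K))
      = fun i => (aeval fun i => (∑ j, B i j • X j : MvPolynomial (Fin 3) K))
          (∑ j, A i j • X j : MvPolynomial (Fin 3) K) := by
    funext i
    rw [map_sum]
    simp only [_root_.map_smul, aeval_X, Matrix.mul_apply, Finset.sum_smul, Finset.smul_sum, smul_smul]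
    exact Finset.sum_comm
  have h1 : substPoly (A * B) F
      = aeval (fun i => (aeval fun i => (∑ j, B i j • X j : MvPolynomial (Fin 3) K))
          (∑ j, A i j • X j : MvPolynomial (Fin 3) K)) F := by
    unfold substPoly
    exact congrArg
      (fun f => (aeval f : MvPolynomial (Fin 3) K →ₐ[K] MvPolynomial (Fin 3) K) F) hfun
  rw [h1, ← MvPolynomial.comp_aeval]
  rfl

/-- The subgroup of `GL₃(K)` preserving the polynomial `F` up to scalar. -/
def autGL (F : MvPolynomial (Fin 3) K) : Subgroup (GL (Fin 3) K) where
  carrier := {A | ∃ c : Kˣ, substPoly (A : Matrix (Fin 3) (Fin 3) K) F = (c : K) • F}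
  one_mem' := ⟨1, by simp [substPoly_one]⟩
  mul_mem' := by
    rintro A B ⟨c, hc⟩ ⟨e, he⟩
    refine ⟨c * e, ?_⟩
    have hAB : ((A * B : GL (Fin 3) K) : Matrix (Fin 3) (Fin 3) K)
        = (A : Matrix (Fin 3) (Fin 3) K) * (B : Matrix (Fin 3) (Fin 3) K) := rfl
    rw [hAB, substPoly_mul, hc, substPoly_smul, he, smul_smul, ← Units.val_mul]
  inv_mem' := by
    rintro A ⟨c, hc⟩
    refine ⟨c⁻¹, ?_⟩
    have key : (c : K) • substPoly ((A⁻¹ : GL (Fin 3) K) : Matrix (Fin 3) (Fin 3) K) F = F := by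
      rw [← substPoly_smul, ← hc, ← substPoly_mul]
      have h1 : (A : Matrix (Fin 3) (Fin 3) K) *
          ((A⁻¹ : GL (Fin 3) K) : Matrix (Fin 3) (Fin 3) K) = 1 := by
        exact_mod_cast Units.mul_inv A
      rw [h1, substPoly_one]
    calc substPoly ((A⁻¹ : GL (Fin 3) K) : Matrix (Fin 3) (Fin 3) K) F
        = ((c : K)⁻¹ * (c : K)) •
            substPoly ((A⁻¹ : GL (Fin 3) K) : Matrix (Fin 3) (Fin 3) K) F := by
          rw [inv_mul_cancel₀ (Units.ne_zero c), one_smul]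
      _ = (c : K)⁻¹ • ((c : K) •
            substPoly ((A⁻¹ : GL (Fin 3) K) : Matrix (Fin 3) (Fin 3) K) F) := by
          rw [smul_smul]
      _ = (c : K)⁻¹ • F := by rw [key]
      _ = ((c⁻¹ : Kˣ) : K) • F := by rw [Units.val_inv_eq_inv_val]

/-- `PGL₃(K)`: the quotient of `GL₃(K)` by its center (the scalar matrices). -/
abbrev PGL3 (K : Type*) [Field K] := GL (Fin 3) K ⧸ Subgroup.center (GL (Fin 3) K)

/-- The automorphism group of the plane curve `F = 0`, as a subgroup of `PGL₃(K)`: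
the classes of matrices `A` with `F ∘ A = λ • F` for some `λ ∈ Kˣ`. -/
def projAut (F : MvPolynomial (Fin 3) K) : Subgroup (PGL3 K) :=
  (autGL F).map (QuotientGroup.mk' (Subgroup.center (GL (Fin 3) K)))

/-- `F` is nonsingular: the only common zero of its partial derivatives is the origin. -/
def IsNonsingular (F : MvPolynomial (Fin 3) K) : Prop :=
  ∀ x : Fin 3 → K, (∀ i, eval x (pderiv i F) = 0) → x = 0

/-- `F` and `G` are projectively equivalent: `F ∘ A = λ • G` for some `A ∈ GL₃(K)`, `λ ∈ Kˣ`. -/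
def ProjEquiv (F G : MvPolynomial (Fin 3) K) : Prop :=
  ∃ A : GL (Fin 3) K, ∃ c : Kˣ,
    substPoly (A : Matrix (Fin 3) (Fin 3) K) F = (c : K) • G


lemma eval_substPoly (A : Matrix (Fin 3) (Fin 3) K) (F : MvPolynomial (Fin 3) K)
    (x : Fin 3 → K) : eval x (substPoly A F) = eval (A *ᵥ x) F := by
  unfold substPoly
  induction F using MvPolynomial.induction_on with
  | C a => simp
  | add p q hp hq => rw [map_add, map_add, map_add, hp, hq]
  | mul_X p i hp =>
    simp only [map_mul, hp, aeval_X, map_sum, eval_X]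
    congr 1
    simp [Matrix.mulVec, dotProduct, smul_eval]

lemma pderiv_substPoly (A : Matrix (Fin 3) (Fin 3) K) (F : MvPolynomial (Fin 3) K) (j : Fin 3) :
    pderiv j (substPoly A F) = ∑ i, A i j • substPoly A (pderiv i F) := by
  unfold substPoly
  induction F using MvPolynomial.induction_on with
  | C a => simp [MvPolynomial.algebraMap_eq]
  | add p q hp hq => simp only [map_add, hp, hq, smul_add, Finset.sum_add_distrib]
  | mul_X p i hp =>
    have h1 : pderiv j (∑ k, A i k • X k : MvPolynomial (Fin 3) K) = C (A i j) := by
      simp [pderiv_X, Pi.single_apply, smul_eq_C_mul]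
    simp only [map_mul, aeval_X, pderiv_mul, h1, hp, map_add, smul_add, Finset.sum_add_distrib,
      pderiv_X, Finset.sum_mul]
    congr 1
    · simp
    · simp [Pi.single_apply, smul_eq_C_mul, mul_comm, apply_ite, Finset.sum_ite_eq]

lemma eval_pderiv_substPoly (A : Matrix (Fin 3) (Fin 3) K) (F : MvPolynomial (Fin 3) K)
    (j : Fin 3) (x : Fin 3 → K) :
    eval x (pderiv j (substPoly A F)) = ∑ i, A i j * eval (A *ᵥ x) (pderiv i F) := by
  rw [pderiv_substPoly, map_sum]
  simp [smul_eval, eval_substPoly]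

/-- The Hessian matrix of `F` at `x`. -/
def hessAt (F : MvPolynomial (Fin 3) K) (x : Fin 3 → K) : Matrix (Fin 3) (Fin 3) K :=
  Matrix.of fun i j => eval x (pderiv i (pderiv j F))

lemma hessAt_substPoly (A : Matrix (Fin 3) (Fin 3) K) (F : MvPolynomial (Fin 3) K)
    (x : Fin 3 → K) :
    hessAt (substPoly A F) x = Aᵀ * hessAt F (A *ᵥ x) * A := by
  ext i j
  simp only [hessAt, Matrix.of_apply, pderiv_substPoly A F j, map_sum, Matrix.mul_apply,
    Matrix.transpose_apply]
  refine Finset.sum_congr rfl fun k _ => ?_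
  rw [Derivation.map_smul, smul_eval, eval_pderiv_substPoly, mul_comm]

lemma hessAt_smul (c : K) (F : MvPolynomial (Fin 3) K) (x : Fin 3 → K) :
    hessAt (c • F) x = c • hessAt F x := by
  ext i j
  simp [hessAt, smul_eval]

lemma det_hessAt_of_aut (A : Matrix (Fin 3) (Fin 3) K) (F : MvPolynomial (Fin 3) K) (c : K)
    (h : substPoly A F = c • F) (x : Fin 3 → K) :
    A.det ^ 2 * (hessAt F (A *ᵥ x)).det = c ^ 3 * (hessAt F x).det := by
  have := congrArg (fun P => (hessAt P x).det) h
  simp only [hessAt_substPoly, hessAt_smul, Matrix.det_mul, Matrix.det_transpose,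
    Matrix.det_smul, Fintype.card_fin] at this
  rw [← this]; ring

lemma IsNonsingular.subst {F : MvPolynomial (Fin 3) K} (hF : IsNonsingular F)
    (A : GL (Fin 3) K) : IsNonsingular (substPoly (A : Matrix (Fin 3) (Fin 3) K) F) := by
  intro x hx
  obtain ⟨M, hM⟩ : ∃ M : Matrix (Fin 3) (Fin 3) K, M = A.val := ⟨_, rfl⟩
  rw [← hM] at hx
  have hu : IsUnit M := hM ▸ A.isUnit
  have hut : IsUnit Mᵀ := by rwa [Matrix.isUnit_transpose]
  have h0 : Mᵀ *ᵥ (fun i => eval (M *ᵥ x) (pderiv i F)) = Mᵀ *ᵥ 0 := by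
    ext j
    have := hx j
    rw [eval_pderiv_substPoly] at this
    simpa [Matrix.mulVec, dotProduct] using this
  have h1 := Matrix.mulVec_injective_of_isUnit hut h0
  have h2 := hF (M *ᵥ x) (fun i => congrFun h1 i)
  exact Matrix.mulVec_injective_of_isUnit hu (h2.trans (Matrix.mulVec_zero M).symm)

lemma isHomogeneous_substPoly {F : MvPolynomial (Fin 3) K} {d : ℕ} (hF : F.IsHomogeneous d)
    (A : Matrix (Fin 3) (Fin 3) K) : (substPoly A F).IsHomogeneous d := by
  have := hF.aeval (fun i => ∑ j, A i j • (X j : MvPolynomial (Fin 3) K)) (n := 1) (fun i => by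
    refine IsHomogeneous.sum _ _ _ fun j _ => ?_
    rw [smul_eq_C_mul]
    simpa using (isHomogeneous_C (Fin 3) (A i j)).mul (isHomogeneous_X K j))
  simpa [substPoly] using this

/-- The normal form. -/
def nf (n : ℕ) (α : K) : MvPolynomial (Fin 3) K :=
  X 0 ^ (n + 1) + X 1 ^ n * X 2 + C α * X 0 * X 2 ^ n

lemma eval_nf (n : ℕ) (α : K) (x : Fin 3 → K) :
    eval x (nf n α) = x 0 ^ (n + 1) + x 1 ^ n * x 2 + α * x 0 * x 2 ^ n := by
  simp [nf]

lemma pderiv0_nf (n : ℕ) (α : K) :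
    pderiv 0 (nf n α) = C ((n : K) + 1) * X 0 ^ n + C α * X 2 ^ n := by
  simp [nf, pderiv_X]; ring

lemma pderiv1_nf (n : ℕ) (α : K) :
    pderiv 1 (nf n α) = C (n : K) * X 1 ^ (n - 1) * X 2 := by
  simp [nf, pderiv_X]; ring

lemma pderiv2_nf (n : ℕ) (α : K) :
    pderiv 2 (nf n α) = X 1 ^ n + C (α * n) * X 0 * X 2 ^ (n - 1) := by
  simp [nf, pderiv_X]; ring

lemma det_hessAt_nf (m : ℕ) (α : K) (x : Fin 3 → K) :
    (hessAt (nf (m + 3) α) x).det = ((m : K) + 3) ^ 3 * (x 1 ^ (m + 1) *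
      (α * (m + 4) * (m + 2) ^ 2 * x 0 ^ (m + 3) * x 2 ^ (m + 2)
        - (m + 4) * x 0 ^ (m + 2) * x 1 ^ (m + 3) - α ^ 2 * (m + 2) * x 2 ^ (2 * m + 5))) := by
  rw [Matrix.det_fin_three]
  simp only [hessAt, Matrix.of_apply, pderiv0_nf, pderiv1_nf, pderiv2_nf]
  simp [pderiv_X]
  ring

/-- The cofactor of `Y ^ (d - 3)` in the Hessian of the normal form. -/
def wf {R : Type*} [CommRing R] (m : ℕ) (α a b c : R) : R :=
  α * (m + 4) * (m + 2) ^ 2 * a ^ (m + 3) * c ^ (m + 2)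
        - (m + 4) * a ^ (m + 2) * b ^ (m + 3) - α ^ 2 * (m + 2) * c ^ (2 * m + 5)

section autnf

variable [CharZero K]

lemma natCast_add_ne (m k : ℕ) [k.AtLeastTwo] : (m : K) + OfNat.ofNat k ≠ 0 := by
  have h : k ≠ 0 := by have := Nat.AtLeastTwo.prop (n := k); omega
  have : ((m + k : ℕ) : K) ≠ 0 := Nat.cast_ne_zero.mpr (by omega)
  rw [Nat.cast_add] at this
  exact this

lemma wf_zero_left {m : ℕ} {α b c : K} (hα : α ≠ 0) (h : wf m α 0 b c = 0) : c = 0 := by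
  have h2 := natCast_add_ne (K := K) m 2
  simp only [wf, ne_eq, Nat.add_eq_zero_iff, OfNat.ofNat_ne_zero, and_false, not_false_eq_true,
    zero_pow, mul_zero, zero_mul, sub_zero, zero_sub, neg_eq_zero, mul_eq_zero,
    pow_eq_zero_iff, hα, h2, false_or, or_false] at h
  exact h

lemma row_one_nf {m : ℕ} {α c : K} (hα : α ≠ 0) {A : Matrix (Fin 3) (Fin 3) K}
    (hdet : A.det ≠ 0) (h : substPoly A (nf (m + 3) α) = c • nf (m + 3) α) :
    A 1 0 = 0 ∧ A 1 2 = 0 := by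
  have h3 := natCast_add_ne (K := K) m 3
  have h4 := natCast_add_ne (K := K) m 4
  have hH : ∀ u : Fin 3 → K, u 1 = 0 →
      (A *ᵥ u) 1 * wf m α ((A *ᵥ u) 0) ((A *ᵥ u) 1) ((A *ᵥ u) 2) = 0 := by
    intro u hu
    have := det_hessAt_of_aut A _ c h u
    rw [det_hessAt_nf, det_hessAt_nf, hu] at this
    rw [zero_pow (Nat.succ_ne_zero m), zero_mul, mul_zero, mul_zero] at this
    have h5 := (mul_eq_zero.mp this).resolve_left (pow_ne_zero _ hdet)
    have h6 := (mul_eq_zero.mp h5).resolve_left (pow_ne_zero _ h3)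
    rw [mul_eq_zero]
    exact (mul_eq_zero.mp h6).imp (fun h => eq_zero_of_pow_eq_zero h) id
  by_contra hcon
  obtain ⟨v, hv1, hv⟩ : ∃ v : Fin 3 → K, v 1 = 0 ∧ (A *ᵥ v) 1 ≠ 0 := by
    by_cases h0 : A 1 0 = 0
    · refine ⟨Pi.single 2 1, by simp, ?_⟩
      simpa using fun h2 => hcon ⟨h0, h2⟩
    · exact ⟨Pi.single 0 1, by simp, by simpa using h0⟩
  have hW : ∀ u : Fin 3 → K, u 1 = 0 →
      wf m α ((A *ᵥ u) 0) ((A *ᵥ u) 1) ((A *ᵥ u) 2) = 0 := by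
    intro u hu
    let q : Fin 3 → Polynomial K := fun i =>
      Polynomial.C ((A *ᵥ u) i) + Polynomial.C ((A *ᵥ v) i) * Polynomial.X
    have hq : q 1 * wf m (Polynomial.C α) (q 0) (q 1) (q 2) = 0 := by
      apply Polynomial.funext
      intro t
      have := hH (u + t • v) (by simp [hu, hv1])
      rw [Matrix.mulVec_add, Matrix.mulVec_smul] at this
      simpa [q, wf, mul_comm t] using this
    have hq1 : q 1 ≠ 0 := by
      intro h0
      have := congrArg (fun p => p.coeff 1) h0
      simp [q] at this
      exact hv this
    have h5 := (mul_eq_zero.mp hq).resolve_left hq1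
    have := congrArg (Polynomial.eval 0) h5
    simpa [q, wf] using this
  have hinj : ∀ u : Fin 3 → K, A *ᵥ u = 0 → u = 0 := by
    intro u hu
    exact Matrix.eq_zero_of_mulVec_eq_zero hdet hu
  obtain ⟨u, hu0, hu1, hu⟩ : ∃ u : Fin 3 → K, u ≠ 0 ∧ u 1 = 0 ∧ (A *ᵥ u) 0 = 0 := by
    by_cases h0 : A 0 2 = 0
    · refine ⟨Pi.single 2 1, by simp, by simp, by simpa using h0⟩
    · refine ⟨![A 0 2, 0, - A 0 0], fun h1 => h0 (by simpa using congrFun h1 0), by simp, ?_⟩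
      simp [Matrix.mulVec, dotProduct, Fin.sum_univ_three]
      ring
  have hu2 : (A *ᵥ u) 2 = 0 := by
    have := hW u hu1
    rw [hu] at this
    exact wf_zero_left hα this
  have huy : (A *ᵥ u) 1 ≠ 0 := by
    intro h1
    apply hu0 (hinj u _)
    ext i
    fin_cases i
    · exact hu
    · exact h1
    · exact hu2
  have hx : ∀ w : Fin 3 → K, w 1 = 0 → (A *ᵥ w) 0 = 0 := by
    intro w hw
    have key : ∀ y : K, wf m α ((A *ᵥ w) 0) y ((A *ᵥ w) 2) = 0 := by
      intro y
      have := hW (w + ((y - (A *ᵥ w) 1) / (A *ᵥ u) 1) • u) (by simp [hw, hu1])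
      rw [Matrix.mulVec_add, Matrix.mulVec_smul] at this
      simpa [hu, hu2, huy] using this
    have e0 := key 0
    have e1 := key 1
    have : ((m : K) + 4) * (A *ᵥ w) 0 ^ (m + 2) = 0 := by
      simp only [wf, ne_eq, Nat.add_eq_zero_iff, OfNat.ofNat_ne_zero, and_false,
        not_false_eq_true, zero_pow, one_pow] at e0 e1
      linear_combination e0 - e1
    simpa [h4] using this
  have hz : ∀ w : Fin 3 → K, w 1 = 0 → (A *ᵥ w) 2 = 0 := by
    intro w hw
    have := hW w hw
    rw [hx w hw] at this
    exact wf_zero_left hα this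
  apply hdet
  have a1 := hx (Pi.single 0 1) (by simp)
  have a2 := hx (Pi.single 2 1) (by simp)
  have a3 := hz (Pi.single 0 1) (by simp)
  have a4 := hz (Pi.single 2 1) (by simp)
  simp at a1 a2 a3 a4
  rw [Matrix.det_fin_three, a1, a2, a3, a4]
  ring

lemma diag_nf {m : ℕ} {α c : K} (hα : α ≠ 0) {A : Matrix (Fin 3) (Fin 3) K}
    (hdet : A.det ≠ 0) (h : substPoly A (nf (m + 3) α) = c • nf (m + 3) α) :
    ∃ t : Fin 3 → K, A = Matrix.diagonal t ∧ t 0 ^ (m + 4) = c ∧ t 1 ^ (m + 3) * t 2 = c ∧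
      t 0 * t 2 ^ (m + 3) = c := by
  have h3 := natCast_add_ne (K := K) m 3
  have h4 : (m : K) + 3 + 1 ≠ 0 := by
    have := natCast_add_ne (K := K) m 4
    convert this using 1; ring
  obtain ⟨h10, h12⟩ := row_one_nf hα hdet h
  have hd2 : A 1 1 * (A 0 0 * A 2 2 - A 0 2 * A 2 0) ≠ 0 := by
    intro h0
    apply hdet
    rw [Matrix.det_fin_three, h10, h12]
    linear_combination h0
  have h11 : A 1 1 ≠ 0 := left_ne_zero_of_mul hd2
  have hD : A 0 0 * A 2 2 - A 0 2 * A 2 0 ≠ 0 := right_ne_zero_of_mul hd2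
  have hE : ∀ x : Fin 3 → K, eval (A *ᵥ x) (nf (m + 3) α) = c * eval x (nf (m + 3) α) := by
    intro x
    rw [← eval_substPoly, h, smul_eval]
  have hG : ∀ (x : Fin 3 → K) j, ∑ i, A i j * eval (A *ᵥ x) (pderiv i (nf (m + 3) α))
      = c * eval x (pderiv j (nf (m + 3) α)) := by
    intro x j
    rw [← eval_pderiv_substPoly, h, Derivation.map_smul, smul_eval]
  -- the derivative in the direction `Y` along `Y = 0`
  have hY : ∀ x z : K, A 0 1 * (((m : K) + 3 + 1) * x ^ (m + 3) + α * z ^ (m + 3))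
      + A 2 1 * (α * (m + 3) * x * z ^ (m + 2)) = 0 := by
    intro x z
    let D := A 0 0 * A 2 2 - A 0 2 * A 2 0
    have := hG ![(A 2 2 * x - A 0 2 * z) / D, 0, (A 0 0 * z - A 2 0 * x) / D] 1
    have e0 : A 0 0 * ((A 2 2 * x - A 0 2 * z) / D) + A 0 2 * ((A 0 0 * z - A 2 0 * x) / D)
        = x := by
      field_simp [D]; ring
    have e2 : A 2 0 * ((A 2 2 * x - A 0 2 * z) / D) + A 2 2 * ((A 0 0 * z - A 2 0 * x) / D)
        = z := by
      field_simp [D]; ring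
    simp [Fin.sum_univ_three, pderiv0_nf, pderiv1_nf, pderiv2_nf, Matrix.mulVec, dotProduct,
      e0, e2, h10, h12] at this
    linear_combination this
  have h01 : A 0 1 = 0 := by
    have := hY 1 0
    simpa [h4] using this
  have h21 : A 2 1 = 0 := by
    have := hY 1 1
    simpa [h01, h3, hα] using this
  have h20 : A 2 0 = 0 := by
    have e0 := hE ![1, 0, 0]
    have e1 := hE ![1, 1, 0]
    simp [eval_nf, Fin.sum_univ_three, Matrix.mulVec, dotProduct, h10, h12, h01, h21] at e0 e1
    have : A 1 1 ^ (m + 3) * A 2 0 = 0 := by linear_combination e1 - e0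
    simpa [h11] using this
  have h00 : A 0 0 ≠ 0 := by
    intro h0; apply hD; rw [h0, h20]; ring
  have h02 : A 0 2 = 0 := by
    have := hG ![1, 0, 0] 2
    simp [Fin.sum_univ_three, pderiv0_nf, pderiv1_nf, pderiv2_nf, Matrix.mulVec, dotProduct,
      h10, h12, h20, h00, h4] at this
    exact this
  have hA : A = Matrix.diagonal (fun i => A i i) := by
    ext i j
    fin_cases i <;> fin_cases j <;> simp [h01, h02, h10, h12, h20, h21]
  refine ⟨fun i => A i i, hA, ?_, ?_, ?_⟩
  · have := hE ![1, 0, 0]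
    simpa [eval_nf, Fin.sum_univ_three, Matrix.mulVec, dotProduct, h10, h12, h01, h02, h20, h21]
      using this
  · have := hE ![0, 1, 1]
    simpa [eval_nf, Fin.sum_univ_three, Matrix.mulVec, dotProduct, h10, h12, h01, h02, h20, h21]
      using this
  · have e0 := hE ![1, 0, 0]
    have e1 := hE ![1, 0, 1]
    simp [eval_nf, Fin.sum_univ_three, Matrix.mulVec, dotProduct, h10, h12, h01, h02, h20, h21]
      at e0 e1
    have : α * (A 0 0 * A 2 2 ^ (m + 3) - c) = 0 := by linear_combination e1 - e0
    exact sub_eq_zero.mp ((mul_eq_zero.mp this).resolve_left hα)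

end autnf

/-- Diagonal matrices. -/
def diagGL : (Fin 3 → Kˣ) →* GL (Fin 3) K :=
  (Units.map (Matrix.diagonalRingHom (Fin 3) K).toMonoidHom).comp
    (MulEquiv.piUnits (M := fun _ : Fin 3 => K)).symm.toMonoidHom

lemma diagGL_val (t : Fin 3 → Kˣ) :
    (diagGL t : Matrix (Fin 3) (Fin 3) K) = Matrix.diagonal (fun i => (t i : K)) := rfl

lemma mk_diagGL_eq_one (t : Fin 3 → Kˣ) :
    (QuotientGroup.mk (diagGL t) : PGL3 K) = 1 ↔ t 0 = t 1 ∧ t 1 = t 2 := by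
  rw [QuotientGroup.eq_one_iff, Matrix.GeneralLinearGroup.mem_center_iff_val_mem_range_scalar,
    diagGL_val]
  constructor
  · rintro ⟨a, ha⟩
    have h : ∀ i, a = (t i : K) := fun i => by
      have := congrFun (congrFun ha i) i
      simpa using this
    exact ⟨Units.ext ((h 0).symm.trans (h 1)), Units.ext ((h 1).symm.trans (h 2))⟩
  · rintro ⟨h1, h2⟩
    refine ⟨t 0, ?_⟩
    ext i j
    fin_cases i <;> fin_cases j <;> simp [h1, h2]

lemma mk_diagGL_zpow_eq_one (t : Fin 3 → Kˣ) (k : ℤ) :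
    (QuotientGroup.mk (diagGL t) : PGL3 K) ^ k = 1 ↔
      t 0 ^ k = t 1 ^ k ∧ t 1 ^ k = t 2 ^ k := by
  rw [← QuotientGroup.mk_zpow, ← map_zpow, mk_diagGL_eq_one]
  rfl

lemma aut_conj {F G : MvPolynomial (Fin 3) K} {A : GL (Fin 3) K} {c : Kˣ}
    (h : substPoly (A : Matrix (Fin 3) (Fin 3) K) F = (c : K) • G) {B : GL (Fin 3) K}
    (hB : B ∈ autGL G) : A * B * A⁻¹ ∈ autGL F := by
  obtain ⟨e, he⟩ := hB
  refine ⟨e, ?_⟩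
  have h1 : substPoly (A * B : GL (Fin 3) K).val F =
      substPoly (A : Matrix (Fin 3) (Fin 3) K) ((e : K) • F) := by
    rw [Units.val_mul, substPoly_mul, h, substPoly_smul, he, substPoly_smul, h, smul_comm]
  rw [Units.val_mul, substPoly_mul, h1, ← substPoly_mul, ← Units.val_mul, mul_inv_cancel,
    Units.val_one, substPoly_one]

lemma projEquiv_symm' {F G : MvPolynomial (Fin 3) K} {A : GL (Fin 3) K} {c : Kˣ}
    (h : substPoly (A : Matrix (Fin 3) (Fin 3) K) F = (c : K) • G) :
    substPoly ((A⁻¹ : GL (Fin 3) K) : Matrix (Fin 3) (Fin 3) K) G = ((c⁻¹ : Kˣ) : K) • F := by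
  have : G = ((c⁻¹ : Kˣ) : K) • substPoly (A : Matrix (Fin 3) (Fin 3) K) F := by
    rw [h, smul_smul, ← Units.val_mul, inv_mul_cancel, Units.val_one, one_smul]
  rw [this, substPoly_smul, ← substPoly_mul, ← Units.val_mul, mul_inv_cancel, Units.val_one,
    substPoly_one]

lemma projAut_zpowers_of_equiv {F G : MvPolynomial (Fin 3) K} {A : GL (Fin 3) K} {c : Kˣ}
    (h : substPoly (A : Matrix (Fin 3) (Fin 3) K) F = (c : K) • G) {D : PGL3 K}
    (hD : projAut G = Subgroup.zpowers D) :
    projAut F = Subgroup.zpowers ((QuotientGroup.mk A : PGL3 K) * D * (QuotientGroup.mk A)⁻¹) := by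
  apply le_antisymm
  · rintro _ ⟨B, hB, rfl⟩
    have h1 := aut_conj (projEquiv_symm' h) hB
    have h2 : (QuotientGroup.mk (A⁻¹ * B * A⁻¹⁻¹) : PGL3 K) ∈ projAut G := ⟨_, h1, rfl⟩
    rw [hD] at h2
    obtain ⟨k, hk⟩ := h2
    refine ⟨k, ?_⟩
    simp only [conj_zpow] at hk ⊢
    rw [hk]
    simp only [QuotientGroup.mk_mul, QuotientGroup.mk_inv, inv_inv, QuotientGroup.mk'_apply]
    group
  · rw [Subgroup.zpowers_le]
    have : D ∈ projAut G := hD ▸ Subgroup.mem_zpowers D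
    obtain ⟨B, hB, rfl⟩ := this
    exact ⟨A * B * A⁻¹, aut_conj h hB, by simp⟩

lemma substPoly_diagonal_nf {n : ℕ} {α c : K} {t : Fin 3 → K} (h0 : t 0 ^ (n + 1) = c)
    (h1 : t 1 ^ n * t 2 = c) (h2 : t 0 * t 2 ^ n = c) :
    substPoly (Matrix.diagonal t) (nf n α) = c • nf n α := by
  have h : ∀ i, (∑ j, Matrix.diagonal t i j • X j : MvPolynomial (Fin 3) K) = C (t i) * X i := by
    intro i
    simp [Matrix.diagonal_apply, smul_eq_C_mul]
  simp only [substPoly, h]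
  simp only [nf, map_add, map_mul, map_pow, aeval_X, aeval_C, algebraMap_eq, smul_eq_C_mul]
  have e0 := congrArg (C : K → MvPolynomial (Fin 3) K) h0
  have e1 := congrArg (C : K → MvPolynomial (Fin 3) K) h1
  have e2 := congrArg (C : K → MvPolynomial (Fin 3) K) h2
  simp only [map_mul, map_pow] at e0 e1 e2
  linear_combination X 0 ^ (n + 1) * e0 + X 1 ^ n * X 2 * e1 + C α * X 0 * X 2 ^ n * e2

lemma projAut_nf [IsAlgClosed K] [CharZero K] (m : ℕ) {α : K} (hα : α ≠ 0) :
    ∃ D : PGL3 K, orderOf D = (m + 3) ^ 2 ∧ projAut (nf (m + 3) α) = Subgroup.zpowers D := by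
  obtain ⟨n, hn⟩ : ∃ n, n = m + 3 := ⟨_, rfl⟩
  have : NeZero (n ^ 2) := ⟨by rw [hn]; positivity⟩
  have : NeZero ((n ^ 2 : ℕ) : K) := ⟨Nat.cast_ne_zero.mpr (NeZero.ne _)⟩
  obtain ⟨ζ0, hζ0⟩ := HasEnoughRootsOfUnity.exists_primitiveRoot K (n ^ 2)
  obtain ⟨ζ, rfl⟩ := hζ0.isUnit (NeZero.ne _)
  have hζ : IsPrimitiveRoot ζ (n ^ 2) := IsPrimitiveRoot.coe_units_iff.mp hζ0
  have hT : ∀ k : ℤ, (QuotientGroup.mk (diagGL ![1, ζ, (ζ ^ n)⁻¹]) : PGL3 K) ^ k = 1 ↔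
      ((n ^ 2 : ℕ) : ℤ) ∣ k := by
    intro k
    rw [mk_diagGL_zpow_eq_one, ← hζ.zpow_eq_one_iff_dvd]
    simp only [Matrix.cons_val_zero, Matrix.cons_val_one, Matrix.cons_val, _root_.one_zpow]
    constructor
    · rintro ⟨h, -⟩; exact h.symm
    · intro h
      refine ⟨h.symm, ?_⟩
      rw [h, _root_.inv_zpow, ← _root_.zpow_natCast, ← _root_.zpow_mul, mul_comm, _root_.zpow_mul, h, _root_.one_zpow, inv_one]
  refine ⟨QuotientGroup.mk (diagGL ![1, ζ, (ζ ^ n)⁻¹]), ?_, ?_⟩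
  · rw [← hn]
    apply Nat.dvd_antisymm
    · rw [orderOf_dvd_iff_pow_eq_one, ← _root_.zpow_natCast, hT]
    · rw [← Int.natCast_dvd_natCast, ← hT, _root_.zpow_natCast, pow_orderOf_eq_one]
  · apply le_antisymm
    · rintro _ ⟨A, ⟨c, hc⟩, rfl⟩
      have hdet : (A : Matrix (Fin 3) (Fin 3) K).det ≠ 0 :=
        ((Matrix.isUnit_iff_isUnit_det _).mp A.isUnit).ne_zero
      obtain ⟨t, hA, h0, h1, h2⟩ := diag_nf hα hdet hc
      have ht : ∀ i, t i ≠ 0 := by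
        rw [hA, Matrix.det_diagonal] at hdet
        intro i
        exact (Finset.prod_ne_zero_iff.mp hdet) i (Finset.mem_univ i)
      obtain ⟨s, hs⟩ : ∃ s : Fin 3 → Kˣ, ∀ i, (s i : K) = t i :=
        ⟨fun i => Units.mk0 (t i) (ht i), fun i => rfl⟩
      have hA' : A = diagGL s := by
        apply Units.ext
        rw [hA, diagGL_val]
        simp only [hs]
      subst hA'
      simp only [← hs, ← Units.val_mul, ← Units.val_pow_eq_pow_val, Units.val_inj] at h0 h1 h2
      have hn1 : m + 4 = n + 1 := by omega
      rw [hn1] at h0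
      rw [← hn] at h1 h2
      have hzn : s 2 ^ n = s 0 ^ n := by
        rw [← h0, pow_succ'] at h2
        exact mul_left_cancel h2
      have hyn : (s 1 / s 0) ^ n = s 0 / s 2 := by
        rw [div_pow, div_eq_div_iff_mul_eq_mul, h1, ← h0, pow_succ']
      have hu : (s 1 / s 0) ^ (n ^ 2) = 1 := by
        rw [pow_two, pow_mul, hyn, div_pow, hzn, div_self']
      obtain ⟨k, -, hk⟩ := hζ0.eq_pow_of_pow_eq_one
        (by rw [← Units.val_pow_eq_pow_val, hu, Units.val_one])
      rw [← Units.val_pow_eq_pow_val, Units.val_inj] at hk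
      refine ⟨k, ?_⟩
      simp only [_root_.zpow_natCast, QuotientGroup.mk'_apply]
      rw [← QuotientGroup.mk_pow, ← map_pow, ← div_eq_one, ← QuotientGroup.mk_div, ← map_div,
        mk_diagGL_eq_one]
      simp only [Pi.div_apply, Pi.pow_apply, Matrix.cons_val_zero, Matrix.cons_val_one,
        Matrix.cons_val, one_pow, hk, inv_pow, ← pow_mul]
      rw [mul_comm n k, pow_mul, hk, hyn]
      constructor
      · simp
      · simp
    · rw [Subgroup.zpowers_le]
      refine ⟨diagGL ![1, ζ, (ζ ^ n)⁻¹], ⟨1, ?_⟩, rfl⟩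
      rw [diagGL_val, ← hn]
      apply substPoly_diagonal_nf
      · simp
      · simp
      · have := hζ.pow_eq_one
        rw [pow_two, pow_mul] at this
        simp [← Units.val_pow_eq_pow_val, this]

lemma exists_diag [IsAlgClosed K] [CharZero K] (A : GL (Fin 3) K) {N : ℕ} (hN : N ≠ 0)
    (hA : A ^ N ∈ Subgroup.center (GL (Fin 3) K)) :
    ∃ (P : GL (Fin 3) K) (t : Fin 3 → Kˣ), P⁻¹ * A * P = diagGL t := by
  classical
  obtain ⟨s, hs⟩ := Matrix.GeneralLinearGroup.mem_center_iff_val_mem_range_scalar.mp hA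
  have hs0 : s ≠ 0 := by
    rintro rfl
    have h1 : IsUnit (A ^ N).val := (A ^ N).isUnit
    rw [← hs, map_zero] at h1
    exact not_isUnit_zero h1
  let f : Module.End K (Fin 3 → K) := Matrix.toLinAlgEquiv' (A : Matrix (Fin 3) (Fin 3) K)
  have hss : f.IsSemisimple := by
    apply Module.End.isSemisimple_of_squarefree_aeval_eq_zero (p := Polynomial.X ^ N - Polynomial.C s)
    · exact (Polynomial.separable_X_pow_sub_C s (Nat.cast_ne_zero.mpr hN) hs0).squarefree
    · have : f ^ N = algebraMap K _ s := by
        rw [← map_pow, ← Units.val_pow_eq_pow_val, ← hs]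
        exact (Matrix.toLinAlgEquiv' (R := K) (n := Fin 3)).commutes s
      simp [this]
  have hint := DirectSum.isInternal_submodule_of_iSupIndep_of_iSup_eq_top
    f.eigenspaces_iSupIndep hss.iSup_eigenspace_eq_top
  let v := hint.collectedBasis fun μ ↦ Module.finBasis K (f.eigenspace μ)
  have : Fintype ((ν : K) × Fin (Module.finrank K (f.eigenspace ν))) :=
    FiniteDimensional.fintypeBasisIndex v
  let e := Fintype.equivFinOfCardEq (n := 3)
    ((Module.finrank_eq_card_basis v).symm.trans (Module.finrank_fin_fun K))
  let w := v.reindex e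
  let μ : Fin 3 → K := fun i => (e.symm i).1
  have hw : ∀ i, (A : Matrix (Fin 3) (Fin 3) K) *ᵥ (w i) = μ i • w i := by
    intro i
    have h1 : f (v (e.symm i)) = μ i • v (e.symm i) :=
      Module.End.mem_eigenspace_iff.mp (hint.collectedBasis_mem _ (e.symm i))
    simpa [w, f, Matrix.toLinAlgEquiv'_apply] using h1
  let Pm : Matrix (Fin 3) (Fin 3) K := Matrix.of fun i j => w j i
  have hP : IsUnit Pm := by
    rw [← Matrix.linearIndependent_cols_iff_isUnit]
    exact w.linearIndependent
  obtain ⟨P, hPP⟩ := hP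
  have hAP : (A : Matrix (Fin 3) (Fin 3) K) * Pm = Pm * Matrix.diagonal μ := by
    ext i j
    have := congrFun (hw j) i
    rw [Matrix.mul_diagonal]
    simp only [Matrix.mul_apply, Pm, Matrix.of_apply]
    simp only [Matrix.mulVec, dotProduct, Pi.smul_apply, smul_eq_mul] at this
    rw [this, mul_comm]
  have hD : (P⁻¹ * A * P).val = Matrix.diagonal μ := by
    rw [mul_assoc, Units.val_mul, Units.val_mul, hPP, hAP, ← hPP, ← mul_assoc, ← Units.val_mul,
      inv_mul_cancel, Units.val_one, one_mul]
  have hμ : ∀ i, μ i ≠ 0 := by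
    have hdet : ((P⁻¹ * A * P).val).det ≠ 0 :=
      ((Matrix.isUnit_iff_isUnit_det _).mp (P⁻¹ * A * P).isUnit).ne_zero
    rw [hD, Matrix.det_diagonal] at hdet
    exact fun i => (Finset.prod_ne_zero_iff.mp hdet) i (Finset.mem_univ i)
  refine ⟨P, fun i => Units.mk0 (μ i) (hμ i), Units.ext ?_⟩
  rw [hD, diagGL_val]
  rfl

lemma coeff_substPoly_diagonal (t : Fin 3 → K) (F : MvPolynomial (Fin 3) K) (m : Fin 3 →₀ ℕ) :
    coeff m (substPoly (Matrix.diagonal t) F) = (∏ i, t i ^ m i) * coeff m F := by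
  have h : ∀ i, (∑ j, Matrix.diagonal t i j • X j : MvPolynomial (Fin 3) K) = C (t i) * X i := by
    intro i
    simp [Matrix.diagonal_apply, smul_eq_C_mul]
  simp only [substPoly, h]
  induction F using MvPolynomial.induction_on' with
  | add p q hp hq => rw [map_add, coeff_add, hp, hq, coeff_add, mul_add]
  | monomial n a =>
    have : aeval (fun i => C (t i) * X i) (monomial n a)
        = (monomial n ((∏ i, t i ^ n i) * a) : MvPolynomial (Fin 3) K) := by
      rw [aeval_monomial, monomial_eq]
      simp only [algebraMap_eq, mul_pow, map_mul, map_prod, map_pow]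
      rw [Finsupp.prod_mul, Finsupp.prod_fintype _ _ (by simp)]
      ring
    rw [this, coeff_monomial, coeff_monomial]
    split_ifs with hnm
    · rw [hnm]
    · simp

lemma exists_coeff_ne {F : MvPolynomial (Fin 3) K} {n : ℕ} (hF : F.IsHomogeneous (n + 1))
    (hns : IsNonsingular F) (i : Fin 3) :
    ∃ j, coeff (Finsupp.single i n + Finsupp.single j 1) F ≠ 0 := by
  by_contra! hcon
  have := hns (Pi.single i 1) (fun j => by
    rw [eval_eq]
    refine Finset.sum_eq_zero fun m hm => ?_
    by_contra hne
    have hprod := right_ne_zero_of_mul hne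
    have hc := left_ne_zero_of_mul hne
    rw [coeff_pderiv] at hc
    have hc' := left_ne_zero_of_mul hc
    have hms : m = Finsupp.single i (m i) := by
      ext l
      by_cases hl : l = i
      · subst hl; simp
      · rw [Finsupp.single_eq_of_ne hl]
        by_contra hml
        have := (Finset.prod_ne_zero_iff.mp hprod) l (Finsupp.mem_support_iff.mpr hml)
        simp [hl, hml] at this
    have hdeg := hF hc'
    have hmi : m i = n := by
      rw [hms] at hdeg
      simp [Finsupp.weight_apply, Finsupp.sum_fintype, Finsupp.single_apply, Finset.sum_add_distrib] at hdeg
      exact hdeg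
    rw [hms, hmi] at hc'
    exact hc' (hcon j))
  have h1 := congrFun this i
  simp at h1

lemma perm_cases : ∀ j : Fin 3 → Fin 3, ∃ σ : Equiv.Perm (Fin 3),
    (j (σ 0) = σ 0 ∧ j (σ 1) = σ 1 ∧ j (σ 2) = σ 2) ∨
    (j (σ 0) = σ 0 ∧ j (σ 1) = σ 1 ∧ j (σ 2) = σ 0) ∨
    (j (σ 0) = σ 0 ∧ j (σ 1) = σ 2 ∧ j (σ 2) = σ 1) ∨
    (j (σ 0) = σ 0 ∧ j (σ 1) = σ 0 ∧ j (σ 2) = σ 0) ∨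
    (j (σ 0) = σ 0 ∧ j (σ 1) = σ 2 ∧ j (σ 2) = σ 0) ∨
    (j (σ 0) = σ 1 ∧ j (σ 1) = σ 2 ∧ j (σ 2) = σ 0) ∨
    (j (σ 0) = σ 1 ∧ j (σ 1) = σ 0 ∧ j (σ 2) = σ 0) := by
  decide

lemma classify {M : Type*} [AddCommGroup M] {n : ℤ} (hn : 3 ≤ n) {t : Fin 3 → M} {v : M}
    {j : Fin 3 → Fin 3} (h : ∀ i, n • t i + t (j i) = v)
    (hord : ∀ k : ℤ, k • t 0 = k • t 1 → k • t 1 = k • t 2 → n ^ 2 ∣ k) :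
    ∃ σ : Equiv.Perm (Fin 3), j (σ 0) = σ 0 ∧ j (σ 1) = σ 2 ∧ j (σ 2) = σ 0 := by
  obtain ⟨σ, hσ⟩ := perm_cases j
  have hord' : ∀ k : ℤ, k • t (σ 0) = k • t (σ 1) → k • t (σ 1) = k • t (σ 2) → n ^ 2 ∣ k := by
    intro k h1 h2
    have h3 : ∀ i, k • t (σ i) = k • t (σ 0) := by
      intro i
      fin_cases i
      · rfl
      · exact h1.symm
      · exact (h1.trans h2).symm
    have h4 : ∀ i, k • t i = k • t (σ 0) := fun i => by
      have := h3 (σ.symm i)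
      rwa [Equiv.apply_symm_apply] at this
    exact hord k ((h4 0).trans (h4 1).symm) ((h4 1).trans (h4 2).symm)
  have hlt : ∀ k : ℤ, n ^ 2 ∣ k → 0 < k → n ^ 2 ≤ k := fun k h1 h2 => Int.le_of_dvd h2 h1
  have e0 := h (σ 0)
  have e1 := h (σ 1)
  have e2 := h (σ 2)
  refine ⟨σ, ?_⟩
  rcases hσ with ⟨a, b, c⟩ | ⟨a, b, c⟩ | ⟨a, b, c⟩ | ⟨a, b, c⟩ | ⟨a, b, c⟩ | ⟨a, b, c⟩ | ⟨a, b, c⟩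
  · exfalso
    rw [a] at e0; rw [b] at e1; rw [c] at e2
    have := hlt _ (hord' (n + 1) (by linear_combination (norm := module) (1 : ℤ) • e0 - (1 : ℤ) • e1)
      (by linear_combination (norm := module) (1 : ℤ) • e1 - (1 : ℤ) • e2)) (by linarith)
    nlinarith
  · exfalso
    rw [a] at e0; rw [b] at e1; rw [c] at e2
    have h1 := hord' (n * (n + 1)) (by linear_combination (norm := module) n • e0 - n • e1)
      (by linear_combination (norm := module) n • e1 - (n + 1) • e2 + (1 : ℤ) • e0)
    have h2 : n ^ 2 ∣ n := by
      have := dvd_sub h1 (dvd_refl (n ^ 2))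
      have h3 : n * (n + 1) - n ^ 2 = n := by ring
      rwa [h3] at this
    have := hlt _ h2 (by linarith)
    nlinarith
  · exfalso
    rw [a] at e0; rw [b] at e1; rw [c] at e2
    have := hlt _ (hord' ((n + 1) * (n - 1))
      (by linear_combination (norm := module) (n - 1) • e0 - n • e1 + (1 : ℤ) • e2)
      (by linear_combination (norm := module) (n + 1) • e1 - (n + 1) • e2)) (by nlinarith)
    nlinarith
  · exfalso
    rw [a] at e0; rw [b] at e1; rw [c] at e2
    have := hlt _ (hord' n (by linear_combination (norm := module) (1 : ℤ) • e0 - (1 : ℤ) • e1)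
      (by linear_combination (norm := module) (1 : ℤ) • e1 - (1 : ℤ) • e2)) (by linarith)
    nlinarith
  · exact ⟨a, b, c⟩
  · exfalso
    rw [a] at e0; rw [b] at e1; rw [c] at e2
    have := hlt _ (hord' (n ^ 2 - n + 1)
      (by linear_combination (norm := module) (n - 1) • e0 - n • e1 + (1 : ℤ) • e2)
      (by linear_combination (norm := module) (n - 1) • e1 - n • e2 + (1 : ℤ) • e0)) (by nlinarith)
    nlinarith
  · exfalso
    rw [a] at e0; rw [b] at e1; rw [c] at e2
    have := hlt _ (hord' (n * (n - 1)) (by linear_combination (norm := module) n • e0 - n • e1)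
      (by linear_combination (norm := module) (n - 1) • e1 - (n - 1) • e2)) (by nlinarith)
    nlinarith

lemma mono_cases {M : Type*} [AddCommGroup M] {n : ℕ} (hn : 3 ≤ n) {x y z v : M}
    (e0 : (n : ℤ) • x + x = v) (e1 : (n : ℤ) • y + z = v)
    (hord : ∀ k : ℤ, k • x = k • y → k • y = k • z → (n : ℤ) ^ 2 ∣ k)
    {i j k : ℕ} (hijk : i + j + k = n + 1)
    (hs : (i : ℤ) • x + (j : ℤ) • y + (k : ℤ) • z = v) :
    (i = n + 1 ∧ j = 0 ∧ k = 0) ∨ (i = 0 ∧ j = n ∧ k = 1) ∨ (i = 1 ∧ j = 0 ∧ k = n) := by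
  have hi : (i : ℤ) = n + 1 - j - k := by omega
  rw [hi] at hs
  have h1 : ((j : ℤ) - n * k) • x = ((j : ℤ) - n * k) • y := by
    linear_combination (norm := module) (-1 : ℤ) • hs + (1 : ℤ) • e0 - (k : ℤ) • e0 + (k : ℤ) • e1
  have h2 : ((j : ℤ) - n * k) • y = ((j : ℤ) - n * k) • z := by
    linear_combination (norm := module) (-(n + 1) : ℤ) • h1 + ((j : ℤ) - n * k) • e0 - ((j : ℤ) - n * k) • e1
  obtain ⟨c, hc⟩ := hord _ h1 h2
  have hj : n ∣ j := by
    rw [← Int.natCast_dvd_natCast]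
    exact ⟨k + n * c, by linear_combination hc⟩
  obtain ⟨j', rfl⟩ := hj
  have hn0 : (n : ℤ) ≠ 0 := by omega
  have hc' : (j' : ℤ) - k = n * c := by
    apply mul_left_cancel₀ hn0
    push_cast at hc
    linear_combination hc
  have hj' : j' < 2 := by
    by_contra hcon
    have : n * 2 ≤ n * j' := Nat.mul_le_mul_left n (by omega)
    omega
  interval_cases j'
  · have hk : n ∣ k := by
      rw [← Int.natCast_dvd_natCast]
      exact ⟨-c, by push_cast at hc'; linear_combination -hc'⟩
    obtain ⟨k', rfl⟩ := hk
    have hk' : k' < 2 := by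
      by_contra hcon
      have : n * 2 ≤ n * k' := Nat.mul_le_mul_left n (by omega)
      omega
    interval_cases k' <;> omega
  · have hk : k ≤ 1 := by omega
    interval_cases k
    · exfalso
      have h3 : (n : ℤ) ∣ 1 := ⟨c, by push_cast at hc'; linear_combination hc'⟩
      have := Int.le_of_dvd one_pos h3
      omega
    · omega

set_option linter.unusedSimpArgs false in
lemma projEquiv_nf_of_diag [IsAlgClosed K] {F : MvPolynomial (Fin 3) K} {n : ℕ}
    (hn : 3 ≤ n) (hF : F.IsHomogeneous (n + 1)) (hns : IsNonsingular F) {t : Fin 3 → Kˣ}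
    (ht : diagGL t ∈ autGL F)
    (hord : orderOf (QuotientGroup.mk (diagGL t) : PGL3 K) = n ^ 2) :
    ∃ α : K, α ≠ 0 ∧ ProjEquiv F (nf n α) := by
  obtain ⟨c, hc⟩ := ht
  have hmon : ∀ m, coeff m F ≠ 0 → ∏ i, t i ^ m i = c := by
    intro m hm
    have h1 := congrArg (coeff m) hc
    rw [diagGL_val, coeff_substPoly_diagonal, coeff_smul, smul_eq_mul] at h1
    have h2 := mul_right_cancel₀ hm h1
    apply Units.ext
    rw [← h2]
    simp
  let T : Fin 3 → Additive Kˣ := fun i => Additive.ofMul (t i)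
  have hmonA : ∀ m, coeff m F ≠ 0 → ∑ i, (m i : ℤ) • T i = Additive.ofMul c := by
    intro m hm
    rw [← hmon m hm, ofMul_prod]
    simp [T]
  choose j hj using exists_coeff_ne hF hns
  have hrel : ∀ i, (n : ℤ) • T i + T (j i) = Additive.ofMul c := by
    intro i
    rw [← hmonA _ (hj i)]
    simp [add_zsmul, Finset.sum_add_distrib, Finsupp.single_apply, ite_smul]
  have hordA : ∀ k : ℤ, k • T 0 = k • T 1 → k • T 1 = k • T 2 → (n : ℤ) ^ 2 ∣ k := by
    intro k h1 h2
    have h3 := (mk_diagGL_zpow_eq_one t k).mpr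
      ⟨Additive.ofMul.injective h1, Additive.ofMul.injective h2⟩
    have h4 := orderOf_dvd_iff_zpow_eq_one.mpr h3
    rw [hord] at h4
    exact_mod_cast h4
  obtain ⟨σ, s0, s1, s2⟩ := classify (by exact_mod_cast hn) hrel hordA
  have hordσ : ∀ k : ℤ, k • T (σ 0) = k • T (σ 1) → k • T (σ 1) = k • T (σ 2) →
      (n : ℤ) ^ 2 ∣ k := by
    intro k h1 h2
    have h3 : ∀ i, k • T (σ i) = k • T (σ 0) := by
      intro i
      fin_cases i
      · rfl
      · exact h1.symm
      · exact (h1.trans h2).symm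
    have h4 : ∀ i, k • T i = k • T (σ 0) := fun i => by
      have := h3 (σ.symm i)
      rwa [Equiv.apply_symm_apply] at this
    exact hordA k ((h4 0).trans (h4 1).symm) ((h4 1).trans (h4 2).symm)
  have e0 := hrel (σ 0)
  have e1 := hrel (σ 1)
  have c0 := hj (σ 0)
  have c1 := hj (σ 1)
  have c2 := hj (σ 2)
  rw [s0] at e0 c0
  rw [s1] at e1 c1
  rw [s2] at c2
  have n01 : σ 0 ≠ σ 1 := σ.injective.ne (by decide)
  have n02 : σ 0 ≠ σ 2 := σ.injective.ne (by decide)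
  have n12 : σ 1 ≠ σ 2 := σ.injective.ne (by decide)
  have hext : ∀ m m' : Fin 3 →₀ ℕ, m (σ 0) = m' (σ 0) → m (σ 1) = m' (σ 1) →
      m (σ 2) = m' (σ 2) → m = m' := by
    intro m m' h0 h1 h2
    have : ∀ i, m (σ i) = m' (σ i) := by
      intro i; fin_cases i <;> assumption
    ext i
    have := this (σ.symm i)
    rwa [Equiv.apply_symm_apply] at this
  have hsupp : ∀ m, coeff m F ≠ 0 → m = Finsupp.single (σ 0) n + Finsupp.single (σ 0) 1 ∨
      m = Finsupp.single (σ 1) n + Finsupp.single (σ 2) 1 ∨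
      m = Finsupp.single (σ 2) n + Finsupp.single (σ 0) 1 := by
    intro m hm
    have hdeg : m (σ 0) + m (σ 1) + m (σ 2) = n + 1 := by
      have h1 := hF hm
      have h2 : ∑ i, m i = n + 1 := by
        simpa [Finsupp.weight_apply, Finsupp.sum_fintype] using h1
      rw [← Equiv.sum_comp σ, Fin.sum_univ_three] at h2
      exact h2
    have hsum := hmonA m hm
    rw [← Equiv.sum_comp σ, Fin.sum_univ_three] at hsum
    rcases mono_cases hn e0 e1 hordσ hdeg hsum with ⟨h0, h1, h2⟩ | ⟨h0, h1, h2⟩ | ⟨h0, h1, h2⟩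
    · left
      apply hext <;> simp [h0, h1, h2, n01, n02, n01.symm, n02.symm]
    · right; left
      apply hext <;> simp [h0, h1, h2, n01, n02, n12, n01.symm, n02.symm, n12.symm]
    · right; right
      apply hext <;> simp [h0, h1, h2, n01, n02, n12, n01.symm, n02.symm, n12.symm]
  obtain ⟨a, ha⟩ : ∃ a, a = coeff (Finsupp.single (σ 0) n + Finsupp.single (σ 0) 1) F := ⟨_, rfl⟩
  obtain ⟨b, hb⟩ : ∃ a, a = coeff (Finsupp.single (σ 1) n + Finsupp.single (σ 2) 1) F := ⟨_, rfl⟩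
  obtain ⟨e, he⟩ : ∃ a, a = coeff (Finsupp.single (σ 2) n + Finsupp.single (σ 0) 1) F := ⟨_, rfl⟩
  rw [← ha] at c0
  rw [← hb] at c1
  rw [← he] at c2
  have d1 : (Finsupp.single (σ 0) n + Finsupp.single (σ 0) 1 : Fin 3 →₀ ℕ) ≠
      Finsupp.single (σ 1) n + Finsupp.single (σ 2) 1 := by
    intro h
    have := DFunLike.congr_fun h (σ 0)
    simp [n01, n02, n01.symm, n02.symm] at this
  have d2 : (Finsupp.single (σ 0) n + Finsupp.single (σ 0) 1 : Fin 3 →₀ ℕ) ≠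
      Finsupp.single (σ 2) n + Finsupp.single (σ 0) 1 := by
    intro h
    have := DFunLike.congr_fun h (σ 0)
    simp [n02, n02.symm] at this
    omega
  have d3 : (Finsupp.single (σ 1) n + Finsupp.single (σ 2) 1 : Fin 3 →₀ ℕ) ≠
      Finsupp.single (σ 2) n + Finsupp.single (σ 0) 1 := by
    intro h
    have := DFunLike.congr_fun h (σ 0)
    simp [n01, n02, n01.symm, n02.symm] at this
  have hFeq : F = monomial (Finsupp.single (σ 0) n + Finsupp.single (σ 0) 1) a
      + monomial (Finsupp.single (σ 1) n + Finsupp.single (σ 2) 1) b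
      + monomial (Finsupp.single (σ 2) n + Finsupp.single (σ 0) 1) e := by
    ext m
    simp only [coeff_add, coeff_monomial]
    by_cases hm : coeff m F = 0
    · rw [hm]
      have q0 : Finsupp.single (σ 0) n + Finsupp.single (σ 0) 1 ≠ m := by
        rintro rfl; exact c0 (ha.trans hm)
      have q1 : Finsupp.single (σ 1) n + Finsupp.single (σ 2) 1 ≠ m := by
        rintro rfl; exact c1 (hb.trans hm)
      have q2 : Finsupp.single (σ 2) n + Finsupp.single (σ 0) 1 ≠ m := by
        rintro rfl; exact c2 (he.trans hm)
      simp [q0, q1, q2]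
    · rcases hsupp m hm with rfl | rfl | rfl
      · rw [if_pos rfl, if_neg d1.symm, if_neg d2.symm, ← ha]; ring
      · rw [if_neg d1, if_pos rfl, if_neg d3.symm, ← hb]; ring
      · rw [if_neg d2, if_neg d3, if_pos rfl, ← he]; ring
  have hFX : F = C a * X (σ 0) ^ (n + 1) + C b * X (σ 1) ^ n * X (σ 2)
      + C e * X (σ 2) ^ n * X (σ 0) := by
    rw [hFeq]
    simp only [monomial_add_single, ← C_mul_X_pow_eq_monomial, pow_one]
    ring
  obtain ⟨β, hβ⟩ := IsAlgClosed.exists_pow_nat_eq (a / b) (n := n) (by omega)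
  have hβ0 : β ≠ 0 := by
    rintro rfl
    rw [zero_pow (by omega)] at hβ
    exact div_ne_zero c0 c1 hβ.symm
  have hbβ : b * β ^ n = a := by rw [hβ]; field_simp
  let S : Fin 3 → K := ![1, β, 1]
  let Mx : Matrix (Fin 3) (Fin 3) K := (Matrix.diagonal S).submatrix σ.symm id
  have hdet : Mx.det ≠ 0 := by
    simp only [Mx]
    rw [Matrix.det_permute, Matrix.det_diagonal]
    apply mul_ne_zero
    · rcases Int.units_eq_one_or (Equiv.Perm.sign σ.symm) with h | h <;> simp [h]
    · simp [S, Fin.prod_univ_three, hβ0]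
  refine ⟨e / a, div_ne_zero c2 c0, Matrix.GeneralLinearGroup.mkOfDetNeZero Mx hdet,
    Units.mk0 a c0, ?_⟩
  have hMx : ∀ i, (∑ j, Mx (σ i) j • X j : MvPolynomial (Fin 3) K) = C (S i) * X i := by
    intro i
    simp [Mx, Matrix.diagonal_apply, smul_eq_C_mul]
  change substPoly Mx F = a • nf n (e / a)
  rw [hFX, substPoly]
  simp only [map_add, map_mul, map_pow, aeval_X, aeval_C, algebraMap_eq]
  rw [hMx, hMx, hMx, nf, smul_eq_C_mul]
  simp only [S, Matrix.cons_val_zero, Matrix.cons_val_one, Matrix.cons_val]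
  have r1 := congrArg (C : K → MvPolynomial (Fin 3) K) hbβ
  have r2 : (C a * C (e / a) : MvPolynomial (Fin 3) K) = C e := by
    rw [← C_mul]; congr 1; field_simp
  simp only [map_mul, map_pow] at r1
  simp only [C_1]
  linear_combination X 1 ^ n * X 2 * r1 - X 0 * X 2 ^ n * r2

/-- a nonsingular plane curve of degree `d ≥ 4` has an automorphism of
order `(d-1)²` iff it is projectively equivalent to `X^d + Y^(d-1)·Z + α·X·Z^(d-1)`
for some `α ≠ 0`; in that case the automorphism group is cyclic of order `(d-1)²`. -/
theorem stmt3 {K : Type*} [Field K] [IsAlgClosed K] [CharZero K]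
    (d : ℕ) (hd : 4 ≤ d) (F : MvPolynomial (Fin 3) K)
    (hhom : F.IsHomogeneous d) (hns : IsNonsingular F) :
    ((∃ g ∈ projAut F, orderOf g = (d - 1) ^ 2) ↔
      ∃ α : K, α ≠ 0 ∧
        ProjEquiv F (X 0 ^ d + X 1 ^ (d - 1) * X 2 + C α * X 0 * X 2 ^ (d - 1))) ∧
    ((∃ g ∈ projAut F, orderOf g = (d - 1) ^ 2) →
      IsCyclic ↥(projAut F) ∧ Nat.card ↥(projAut F) = (d - 1) ^ 2) := by
  obtain ⟨m, rfl⟩ : ∃ m, d = m + 4 := ⟨d - 4, by omega⟩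
  have hd1 : m + 4 - 1 = m + 3 := by omega
  rw [hd1]
  have hfwd : (∃ g ∈ projAut F, orderOf g = (m + 3) ^ 2) →
      ∃ α : K, α ≠ 0 ∧ ProjEquiv F (nf (m + 3) α) := by
    rintro ⟨g, ⟨A, hA, rfl⟩, hg⟩
    have hc : A ^ ((m + 3) ^ 2) ∈ Subgroup.center (GL (Fin 3) K) := by
      rw [← QuotientGroup.eq_one_iff, QuotientGroup.mk_pow, ← hg]
      exact pow_orderOf_eq_one _
    obtain ⟨P, t, hP⟩ := exists_diag A (by positivity) hc
    have hP1 : substPoly (P : Matrix (Fin 3) (Fin 3) K) F =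
        ((1 : Kˣ) : K) • substPoly (P : Matrix (Fin 3) (Fin 3) K) F := by simp
    have h1 := aut_conj (projEquiv_symm' hP1) hA
    rw [inv_inv, hP] at h1
    have h2 : orderOf (QuotientGroup.mk (diagGL t) : PGL3 K) = (m + 3) ^ 2 := by
      rw [← hg, ← hP]
      simp only [QuotientGroup.mk_mul, QuotientGroup.mk_inv, QuotientGroup.mk'_apply]
      have := orderOf_injective (MulAut.conj (QuotientGroup.mk P : PGL3 K)⁻¹).toMonoidHom
        (MulAut.conj (QuotientGroup.mk P : PGL3 K)⁻¹).injective (QuotientGroup.mk A)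
      simpa using this
    obtain ⟨α, hα, B, c, hB⟩ := projEquiv_nf_of_diag (n := m + 3) (by omega)
      (isHomogeneous_substPoly hhom P.val) (hns.subst P) h1 h2
    refine ⟨α, hα, P * B, c, ?_⟩
    rw [Units.val_mul, substPoly_mul, hB]
  have hcyc : ∀ α : K, α ≠ 0 → ProjEquiv F (nf (m + 3) α) →
      ∃ D : PGL3 K, orderOf D = (m + 3) ^ 2 ∧ projAut F = Subgroup.zpowers D := by
    rintro α hα ⟨A, c, hA⟩
    obtain ⟨D, hD, hz⟩ := projAut_nf m hα
    refine ⟨_, ?_, projAut_zpowers_of_equiv hA hz⟩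
    rw [← hD]
    have := orderOf_injective (MulAut.conj (QuotientGroup.mk A : PGL3 K)).toMonoidHom
        (MulAut.conj (QuotientGroup.mk A : PGL3 K)).injective D
    simpa using this
  refine ⟨⟨hfwd, ?_⟩, ?_⟩
  · rintro ⟨α, hα, h⟩
    obtain ⟨D, hD, hz⟩ := hcyc α hα h
    exact ⟨D, hz ▸ Subgroup.mem_zpowers D, hD⟩
  · intro h
    obtain ⟨α, hα, h⟩ := hfwd h
    obtain ⟨D, hD, hz⟩ := hcyc α hα h
    rw [hz, Nat.card_zpowers, hD]
    exact ⟨inferInstance, rfl⟩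

end
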